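/- arXiv:2211.07694 — 2 statements merged into one kernel-verified Lean document; each statement's English description precedes it below -/
import Mathlib

section
/- Let X_i ⊂ ℝ be compact intervals, μ_i ∈ P(X_i) for i = 1, ..., d, and let ν = f_# Leb_{[0,1]} for a smooth map f : [0,1] → ℝ^n each of whose components is positive and monotone increasing. Let b = (b_1, ..., b_n) : X_1 × ... × X_d → ℝ^n with each component b_j ∈ C² supermodular and monotone increasing in each variable x_i. Then the measure ((m, x_1, ..., x_d) ↦ (f(m), x_1, ..., x_d))_# π, where π = (id, F_{μ_1}^{-1}, ..., F_{μ_d}^{-1})_# Leb_{[0,1]} is the comonotone coupling of Leb_{[0,1]}, μ_1, ..., μ_d, maximizes ∫ b(x_1, ..., x_d) · y dπ over all π ∈ Γ(ν, μ_1, ..., μ_d). -/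
open MeasureTheory Set

/-- Quantile (generalized inverse c.d.f.) of a probability measure on ℝ. -/
noncomputable def quantile (μ : Measure ℝ) (m : ℝ) : ℝ :=
  sInf {x : ℝ | ENNReal.ofReal m ≤ μ (Iic x)}

/-- Lebesgue measure restricted to `[0,1]`. -/
noncomputable def lebI : Measure ℝ := volume.restrict (Icc (0:ℝ) 1)

/-- Mixed second partial derivative `∂²b/∂x_i∂x_j`. -/
noncomputable def partial2 {n : ℕ} (s : (Fin n → ℝ) → ℝ) (i j : Fin n)
    (x : Fin n → ℝ) : ℝ :=
  fderiv ℝ (fun y => fderiv ℝ s y (Pi.single i 1)) x (Pi.single j 1)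

theorem discrete {D Ω Ω' : Type*} [Fintype D] [DecidableEq D] [MeasurableSpace Ω] [MeasurableSpace Ω']
    (P : Measure Ω) (Q : Measure Ω') [IsProbabilityMeasure P] [IsProbabilityMeasure Q]
    (φ : (D → ℕ) → ℝ)
    (hφ : ∀ x y : D → ℕ, x ≤ y → ∀ k, ∀ s t : ℕ, s ≤ t →
      φ (Function.update x k t) + φ (Function.update y k s) ≤
      φ (Function.update x k s) + φ (Function.update y k t)) (N : ℕ) :
    ∀ (T : D → ℕ), ∑ k, T k = N → ∀ (X : Ω → D → ℕ) (g : Ω' → D → ℕ), Measurable X → Measurable g →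
    (∀ ω, X ω ≤ T) → (∀ u, g u ≤ T) → (∀ u v, g u ≤ g v ∨ g v ≤ g u) →
    (∀ k, P.map (fun ω => X ω k) = Q.map (fun u => g u k)) →
    ∫ ω, φ (X ω) ∂P ≤ ∫ u, φ (g u) ∂Q := by
  have integ : ∀ {Ω : Type _} [MeasurableSpace Ω] (P : Measure Ω) [IsProbabilityMeasure P] (X : Ω → D → ℕ) (T : D → ℕ),
      Measurable X → (∀ ω, X ω ≤ T) → Integrable (fun ω => φ (X ω)) P := by
    intro Ω _ P _ X T hX hT
    obtain ⟨C, hC⟩ := ((Set.finite_Iic T).image (fun v => ‖φ v‖)).bddAbove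
    refine Integrable.of_bound ((measurable_of_countable φ).comp hX).aestronglyMeasurable C ?_
    exact Filter.Eventually.of_forall fun ω => hC ⟨X ω, hT ω, rfl⟩
  have integ' : ∀ {Ω : Type _} [MeasurableSpace Ω] (P : Measure Ω) [IsProbabilityMeasure P] (X : Ω → D → ℕ) (T : D → ℕ),
      Measurable X → (∀ ω, X ω ≤ T) → Integrable (fun ω => φ (X ω)) P := by
    intro Ω _ P _ X T hX hT
    obtain ⟨C, hC⟩ := ((Set.finite_Iic T).image (fun v => ‖φ v‖)).bddAbove
    refine Integrable.of_bound ((measurable_of_countable φ).comp hX).aestronglyMeasurable C ?_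
    exact Filter.Eventually.of_forall fun ω => hC ⟨X ω, hT ω, rfl⟩
  induction N with
  | zero =>
    intro T hT X g hX hg hXT hgT hc hlaw
    have hT0 : T = 0 := by
      ext k; simpa using (Finset.sum_eq_zero_iff.1 hT) k (Finset.mem_univ k)
    subst hT0
    have h1 : ∀ ω, X ω = 0 := fun ω => le_antisymm (hXT ω) (fun _ => Nat.zero_le _)
    have h2 : ∀ ω, g ω = 0 := fun ω => le_antisymm (hgT ω) (fun _ => Nat.zero_le _)
    simp [h1, h2]
  | succ N ih =>
    intro T hT X g hX hg hXT hgT hc hlaw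
    obtain ⟨k, hk, hmin⟩ : ∃ k, 0 < T k ∧ ∀ u, g u k = T k → g u = T := by
      have hne : (Finset.univ.filter (fun k => 0 < T k)).Nonempty := by
        by_contra h
        rw [Finset.not_nonempty_iff_eq_empty, Finset.filter_eq_empty_iff] at h
        have : ∑ k, T k = 0 := Finset.sum_eq_zero fun k hk => by
          have := h hk; omega
        omega
      obtain ⟨k, hk⟩ := Finset.exists_minimalFor (fun k => {u | g u k = T k}) _ hne
      have hk0 : 0 < T k := (Finset.mem_filter.1 hk.1).2
      refine ⟨k, hk0, fun u hu => ?_⟩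
      ext l
      by_cases hl : 0 < T l
      · by_contra hul
        have hsub : {u | g u l = T l} ⊆ {u | g u k = T k} := by
          intro v hv
          simp only [Set.mem_ofPred_eq] at hv ⊢
          rcases hc u v with h | h
          · exact le_antisymm (hgT v k) (hu ▸ h k)
          · exact absurd (le_antisymm (hgT u l) (hv ▸ h l)) hul
        exact hul (hk.2 (Finset.mem_filter.2 ⟨Finset.mem_univ l, hl⟩) hsub hu)
      · have : g u l ≤ T l := hgT u l
        omega
    set r : (D → ℕ) → (D → ℕ) := fun v => Function.update v k (min (v k) (T k - 1)) with hr
    have hrm : Measurable r := measurable_of_countable r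
    have hrmono : Monotone r := by
      intro v w h l
      by_cases hl : l = k
      · subst hl; simp only [hr, Function.update_self]; exact min_le_min_right _ (h l)
      · simp only [hr, Function.update_of_ne hl]; exact h l
    have hrT : r T = Function.update T k (T k - 1) := by simp [hr]
    have hsum : ∑ l, r T l = N := by
      rw [hrT]
      have h1 := Finset.sum_update_of_mem (Finset.mem_univ k) T (T k - 1)
      have h2 := Finset.sum_update_of_mem (Finset.mem_univ k) T (T k)
      rw [Function.update_eq_self] at h2
      omega
    have key := ih (r T) hsum (fun ω => r (X ω)) (fun u => r (g u)) (hrm.comp hX) (hrm.comp hg)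
      (fun ω => hrmono (hXT ω)) (fun u => hrmono (hgT u))
      (fun u v => (hc u v).imp (fun h => hrmono h) (fun h => hrmono h)) (by
        intro l
        have hrl : ∃ q : ℕ → ℕ, ∀ v, r v l = q (v l) := by
          by_cases hl : l = k
          · subst hl; exact ⟨fun z => min z (T l - 1), fun v => by simp [hr]⟩
          · exact ⟨id, fun v => by simp [hr, hl]⟩
        obtain ⟨q, hq⟩ := hrl
        have hqm : Measurable q := measurable_of_countable q
        simp only [hq]
        have h1 := Measure.map_map (μ := P) hqm ((measurable_pi_apply l).comp hX)
        have h2 := Measure.map_map (μ := Q) hqm ((measurable_pi_apply l).comp hg)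
        have h3 := hlaw l
        simp only [Function.comp_def] at h1 h2
        rw [← h1, ← h2, h3])
    set δ := φ T - φ (r T) with hδ
    have hrlt : ∀ v, v ≤ T → v k ≠ T k → r v = v := by
      intro v hv h
      have : v k ≤ T k := hv k
      simp only [hr]
      rw [min_eq_left (show v k ≤ T k - 1 by omega), Function.update_eq_self]
    have hXle : ∀ ω, φ (X ω) ≤ φ (r (X ω)) + {ω | X ω k = T k}.indicator (fun _ => δ) ω := by
      intro ω
      by_cases h : X ω k = T k
      · rw [Set.indicator_of_mem (by exact h)]
        have := hφ (X ω) T (hXT ω) k (T k - 1) (T k) (by omega)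
        rw [Function.update_eq_self, ← h, Function.update_eq_self, h, ← hrT] at this
        have h' : r (X ω) = Function.update (X ω) k (T k - 1) := by simp [hr, h]
        rw [h']; linarith
      · rw [Set.indicator_of_notMem (by exact h), hrlt _ (hXT ω) h, add_zero]
    have hgeq : ∀ u, φ (g u) = φ (r (g u)) + {u | g u k = T k}.indicator (fun _ => δ) u := by
      intro u
      by_cases h : g u k = T k
      · rw [Set.indicator_of_mem (by exact h), hmin u h]; ring
      · rw [Set.indicator_of_notMem (by exact h), hrlt _ (hgT u) h, add_zero]
    have mA : MeasurableSet {ω | X ω k = T k} := ((measurable_pi_apply k).comp hX) (measurableSet_singleton (T k))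
    have mB : MeasurableSet {ω | g ω k = T k} := ((measurable_pi_apply k).comp hg) (measurableSet_singleton (T k))
    have hPQ : P.real {ω | X ω k = T k} = Q.real {u | g u k = T k} := by
      have h3 := congrArg (fun m => m {T k}) (hlaw k)
      rw [Measure.map_apply (show Measurable (fun ω => X ω k) from (measurable_pi_apply k).comp hX) (measurableSet_singleton (T k)),
        Measure.map_apply (show Measurable (fun ω => g ω k) from (measurable_pi_apply k).comp hg) (measurableSet_singleton (T k))] at h3
      exact congrArg ENNReal.toReal h3
    have i1 := integ P (fun ω => r (X ω)) (r T) (hrm.comp hX) (fun ω => hrmono (hXT ω))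
    have i2 := integ' Q (fun ω => r (g ω)) (r T) (hrm.comp hg) (fun ω => hrmono (hgT ω))
    have i3 : Integrable ({ω | X ω k = T k}.indicator (fun _ => δ)) P := (integrable_const δ).indicator mA
    have i4 : Integrable ({ω | g ω k = T k}.indicator (fun _ => δ)) Q := (integrable_const δ).indicator mB
    calc ∫ ω, φ (X ω) ∂P ≤ ∫ ω, (φ (r (X ω)) + {ω | X ω k = T k}.indicator (fun _ => δ) ω) ∂P :=
          integral_mono (integ P X T hX hXT) (i1.add i3) hXle
      _ = ∫ ω, φ (r (X ω)) ∂P + P.real {ω | X ω k = T k} * δ := by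
          rw [integral_add i1 i3, integral_indicator_const _ mA, smul_eq_mul]
      _ ≤ ∫ ω, φ (r (g ω)) ∂Q + Q.real {ω | g ω k = T k} * δ := by rw [hPQ]; linarith
      _ = ∫ u, φ (g u) ∂Q := by
          rw [integral_congr_ae (Filter.Eventually.of_forall hgeq), integral_add i2 i4,
            integral_indicator_const _ mB, smul_eq_mul]

theorem cont {D Ω Ω' : Type*} [Fintype D] [DecidableEq D] [MeasurableSpace Ω] [MeasurableSpace Ω']
    (P : Measure Ω) (Q : Measure Ω') [IsProbabilityMeasure P] [IsProbabilityMeasure Q]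
    (φ : (D → ℝ) → ℝ) (hc : Continuous φ)
    (hφ : ∀ x y : D → ℝ, x ≤ y → ∀ k, ∀ s t : ℝ, s ≤ t →
      φ (Function.update x k t) + φ (Function.update y k s) ≤
      φ (Function.update x k s) + φ (Function.update y k t))
    (lo hi : D → ℝ) (X : Ω → D → ℝ) (g : Ω' → D → ℝ) (hX : Measurable X) (hg : Measurable g)
    (hXT : ∀ ω, X ω ∈ Icc lo hi) (hgT : ∀ u, g u ∈ Icc lo hi) (hco : ∀ u v, g u ≤ g v ∨ g v ≤ g u)
    (hlaw : ∀ k, P.map (fun ω => X ω k) = Q.map (fun u => g u k)) :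
    ∫ ω, φ (X ω) ∂P ≤ ∫ u, φ (g u) ∂Q := by
  set v : ℕ → (D → ℝ) → (D → ℕ) := fun N x k => ⌊(x k - lo k) * (N + 1 : ℝ)⌋₊ with hv
  set w : ℕ → (D → ℕ) → (D → ℝ) := fun N z k => lo k + (z k : ℝ) / (N + 1 : ℝ) with hw
  have hvm : ∀ N, Measurable (v N) := by
    intro N
    refine measurable_pi_lambda _ fun k => ?_
    exact Nat.measurable_floor.comp (((measurable_pi_apply k).sub_const _).mul_const _)
  have hvmono : ∀ N, Monotone (v N) := by
    intro N x y h k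
    simp only [hv]
    have := h k
    gcongr
  have hwmono : ∀ N, Monotone (w N) := by
    intro N x y h k
    simp only [hw]
    have := h k
    gcongr
  have hwu : ∀ N z k t, w N (Function.update z k t) = Function.update (w N z) k (lo k + (t : ℝ) / (N + 1 : ℝ)) := by
    intro N z k t
    ext l
    by_cases hl : l = k
    · subst hl; simp [hw]
    · simp [hw, hl]
  have hwv : ∀ N, ∀ x ∈ Icc lo hi, w N (v N x) ∈ Icc lo hi := by
    intro N x hx
    constructor
    · intro k; simp only [hw]; 
      have : (0:ℝ) ≤ (v N x k : ℝ) / (N + 1 : ℝ) := by positivity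
      linarith
    · intro k
      have h0 : 0 ≤ x k - lo k := sub_nonneg.2 (hx.1 k)
      have h1 : (v N x k : ℝ) ≤ (x k - lo k) * (N + 1) := Nat.floor_le (by positivity)
      have h2 : (v N x k : ℝ) / (N + 1 : ℝ) ≤ x k - lo k := by
        rw [div_le_iff₀ (by positivity)]; exact h1
      have := hx.2 k
      simp only [hw]; linarith
  have hlim : ∀ x ∈ Icc lo hi, Filter.Tendsto (fun N => φ (w N (v N x))) Filter.atTop (nhds (φ x)) := by
    intro x hx
    refine (hc.tendsto x).comp ?_
    rw [tendsto_pi_nhds]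
    intro k
    have h0 : 0 ≤ x k - lo k := sub_nonneg.2 (hx.1 k)
    have h1 := (tendsto_nat_floor_mul_div_atTop h0).comp
      (Filter.tendsto_atTop_add_const_right _ (1:ℝ) (tendsto_natCast_atTop_atTop (R := ℝ)))
    have h2 := h1.const_add (lo k)
    simpa [hw, hv, Function.comp_def] using h2
  obtain ⟨C, hC⟩ := (isCompact_Icc (a := lo) (b := hi)).exists_bound_of_continuousOn hc.continuousOn
  have hφm : Measurable φ := hc.measurable
  have l1 : Filter.Tendsto (fun N => ∫ ω, φ (w N (v N (X ω))) ∂P) Filter.atTop (nhds (∫ ω, φ (X ω) ∂P)) := by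
    refine tendsto_integral_of_dominated_convergence (fun _ => C) ?_ (integrable_const _) ?_ ?_
    · intro N
      exact (hφm.comp ((measurable_of_countable (w N)).comp ((hvm N).comp hX))).aestronglyMeasurable
    · intro N
      exact Filter.Eventually.of_forall fun ω => hC _ (hwv N _ (hXT ω))
    · exact Filter.Eventually.of_forall fun ω => hlim _ (hXT ω)
  have l2 : Filter.Tendsto (fun N => ∫ ω, φ (w N (v N (g ω))) ∂Q) Filter.atTop (nhds (∫ ω, φ (g ω) ∂Q)) := by
    refine tendsto_integral_of_dominated_convergence (fun _ => C) ?_ (integrable_const _) ?_ ?_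
    · intro N
      exact (hφm.comp ((measurable_of_countable (w N)).comp ((hvm N).comp hg))).aestronglyMeasurable
    · intro N
      exact Filter.Eventually.of_forall fun ω => hC _ (hwv N _ (hgT ω))
    · exact Filter.Eventually.of_forall fun ω => hlim _ (hgT ω)
  refine le_of_tendsto_of_tendsto' l1 l2 fun N => ?_
  refine discrete P Q (fun z => φ (w N z)) ?_ _ (v N hi) rfl (fun ω => v N (X ω)) (fun u => v N (g u))
    ((hvm N).comp hX) ((hvm N).comp hg) (fun ω => hvmono N (hXT ω).2) (fun ω => hvmono N (hgT ω).2)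
    (fun u u' => (hco u u').imp (fun h => hvmono N h) (fun h => hvmono N h)) ?_
  · intro x y hxy k s t hst
    simp only [hwu]
    apply hφ _ _ (hwmono N hxy)
    gcongr
  · intro l
    have hqm : Measurable (fun z : ℝ => ⌊(z - lo l) * (N + 1 : ℝ)⌋₊) :=
      Nat.measurable_floor.comp ((measurable_id.sub_const _).mul_const _)
    have h1 := Measure.map_map (μ := P) hqm ((measurable_pi_apply l).comp hX)
    have h2 := Measure.map_map (μ := Q) hqm ((measurable_pi_apply l).comp hg)
    have h3 := hlaw l
    simp only [Function.comp_def] at h1 h2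
    simp only [hv]
    rw [← h1, ← h2, h3]

theorem quantile_le (μ : Measure ℝ) [IsProbabilityMeasure μ] (m x : ℝ) (hm : m ∈ Ioo (0:ℝ) 1) :
    quantile μ m ≤ x ↔ ENNReal.ofReal m ≤ μ (Iic x) := by
  have hS : ∀ x, ENNReal.ofReal m ≤ μ (Iic x) ↔ m ≤ ProbabilityTheory.cdf μ x := by
    intro x
    rw [← ProbabilityTheory.ofReal_cdf, ENNReal.ofReal_le_ofReal_iff (ProbabilityTheory.cdf_nonneg μ x)]
  rw [hS]
  unfold quantile
  simp only [hS]
  have hbdd : BddBelow {x | m ≤ ProbabilityTheory.cdf μ x} := by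
    obtain ⟨y, hy⟩ := ((ProbabilityTheory.tendsto_cdf_atBot μ).eventually (gt_mem_nhds hm.1)).exists
    refine ⟨y, fun z hz => ?_⟩
    by_contra h
    have := ProbabilityTheory.monotone_cdf μ (not_le.1 h).le
    have hz' : m ≤ ProbabilityTheory.cdf μ z := hz
    linarith
  have hne : {x | m ≤ ProbabilityTheory.cdf μ x}.Nonempty := by
    obtain ⟨y, hy⟩ := ((ProbabilityTheory.tendsto_cdf_atTop μ).eventually (lt_mem_nhds hm.2)).exists
    exact ⟨y, hy.le⟩
  constructor
  · intro h
    have hr := ((ProbabilityTheory.cdf μ).right_continuous x).tendsto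
    have hr' := hr.mono_left (nhdsWithin_mono x Ioi_subset_Ici_self)
    refine ge_of_tendsto hr' ?_
    filter_upwards [self_mem_nhdsWithin] with y hy
    obtain ⟨z, hz, hzy⟩ := exists_lt_of_csInf_lt hne (lt_of_le_of_lt h hy)
    exact le_trans hz (ProbabilityTheory.monotone_cdf μ hzy.le)
  · intro h
    exact csInf_le hbdd h

theorem lebI_eq : lebI = volume.restrict (Ioo (0:ℝ) 1) := Measure.restrict_congr_set Ioo_ae_eq_Icc.symm

instance : IsProbabilityMeasure lebI := ⟨by simp [lebI]⟩

noncomputable def mid (m : ℝ) : ℝ := if m ∈ Ioo (0:ℝ) 1 then m else 1/2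

theorem mid_mem (m : ℝ) : mid m ∈ Ioo (0:ℝ) 1 := by
  unfold mid
  split_ifs with h
  · exact h
  · norm_num

theorem measurable_mid : Measurable mid :=
  Measurable.ite measurableSet_Ioo measurable_id measurable_const

theorem mid_ae : ∀ᵐ m ∂lebI, mid m = m := by
  rw [lebI_eq]
  filter_upwards [ae_restrict_mem measurableSet_Ioo] with m hm
  simp only [mid, if_pos hm]

theorem quantile_mid_measurable (μ : Measure ℝ) [IsProbabilityMeasure μ] :
    Measurable (fun m => quantile μ (mid m)) := by
  refine measurable_of_Iic fun x => ?_
  have : (fun m => quantile μ (mid m)) ⁻¹' Iic x = {m | ENNReal.ofReal (mid m) ≤ μ (Iic x)} := by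
    ext m
    exact quantile_le μ _ x (mid_mem m)
  rw [this]
  exact measurableSet_le (ENNReal.measurable_ofReal.comp measurable_mid) measurable_const

theorem quantile_mono (μ : Measure ℝ) [IsProbabilityMeasure μ] : MonotoneOn (quantile μ) (Ioo 0 1) := by
  intro m hm m' hm' h
  rw [quantile_le μ _ _ hm]
  exact (ENNReal.ofReal_le_ofReal h).trans ((quantile_le μ _ _ hm').1 le_rfl)

theorem quantile_aemeas (μ : Measure ℝ) [IsProbabilityMeasure μ] : AEMeasurable (quantile μ) lebI :=
  ⟨_, quantile_mid_measurable μ, by filter_upwards [mid_ae] with m hm; rw [hm]⟩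

theorem quantile_law (μ : Measure ℝ) [IsProbabilityMeasure μ] : lebI.map (quantile μ) = μ := by
  have : IsProbabilityMeasure (lebI.map (quantile μ)) := Measure.isProbabilityMeasure_map (quantile_aemeas μ)
  refine Measure.ext_of_Iic _ _ fun x => ?_
  rw [Measure.map_apply_of_aemeasurable (quantile_aemeas μ) measurableSet_Iic]
  have h1 : lebI (quantile μ ⁻¹' Iic x) = lebI (Iic (ProbabilityTheory.cdf μ x)) := by
    refine measure_congr ?_
    rw [lebI_eq]
    filter_upwards [ae_restrict_mem measurableSet_Ioo] with m hm
    refine propext ?_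
    change quantile μ m ≤ x ↔ m ≤ ProbabilityTheory.cdf μ x
    rw [quantile_le μ _ _ hm, ← ProbabilityTheory.ofReal_cdf, ENNReal.ofReal_le_ofReal_iff (ProbabilityTheory.cdf_nonneg μ x)]
  rw [h1, lebI, Measure.restrict_apply measurableSet_Iic]
  have h2 : Iic (ProbabilityTheory.cdf μ x) ∩ Icc 0 1 = Icc 0 (ProbabilityTheory.cdf μ x) := by
    have := ProbabilityTheory.cdf_le_one μ x
    ext z; simp only [mem_inter_iff, mem_Iic, mem_Icc]
    constructor
    · rintro ⟨h, h', -⟩; exact ⟨h', h⟩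
    · rintro ⟨h, h'⟩; exact ⟨h', h, h'.trans this⟩
  rw [h2, Real.volume_Icc, sub_zero, ProbabilityTheory.ofReal_cdf]

theorem idiff {d : ℕ} (s : (Fin d → ℝ) → ℝ) (hs : ContDiff ℝ 2 s) (a c : Fin d → ℝ)
    (hsup : ∀ i i' : Fin d, i ≠ i' → ∀ x ∈ Icc a c, 0 ≤ partial2 s i i' x)
    (x y : Fin d → ℝ) (hx : x ∈ Icc a c) (hy : y ∈ Icc a c) (hxy : x ≤ y) (i : Fin d) (t t' : ℝ)
    (ht : t ∈ Icc (a i) (c i)) (ht' : t' ∈ Icc (a i) (c i)) (htt : t ≤ t') :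
    s (Function.update x i t') + s (Function.update y i t) ≤
      s (Function.update x i t) + s (Function.update y i t') := by
  have hd : Differentiable ℝ s := hs.differentiable (by norm_num)
  have hp : Differentiable ℝ (fun z => fderiv ℝ s z (Pi.single i 1)) := by
    have : ContDiff ℝ 1 (fderiv ℝ s) := hs.fderiv_right (by norm_num)
    exact (this.differentiable (by norm_num)).clm_apply (differentiable_const _)
  have hupd : ∀ z ∈ Icc a c, ∀ r ∈ Icc (a i) (c i), Function.update z i r ∈ Icc a c := by
    intro z hz r hr
    constructor
    · intro l
      by_cases hl : l = i
      · subst hl; simpa using hr.1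
      · simpa [hl] using hz.1 l
    · intro l
      by_cases hl : l = i
      · subst hl; simpa using hr.2
      · simpa [hl] using hz.2 l
  have hder : ∀ z r, HasDerivAt (fun r => s (Function.update z i r))
      (fderiv ℝ s (Function.update z i r) (Pi.single i 1)) r := by
    intro z r
    exact (hd _).hasFDerivAt.comp_hasDerivAt r (hasDerivAt_update z i r)
  have hgrad : ∀ r ∈ Icc (a i) (c i), fderiv ℝ s (Function.update x i r) (Pi.single i 1) ≤
      fderiv ℝ s (Function.update y i r) (Pi.single i 1) := by
    intro r hr
    set p := Function.update x i r
    set q := Function.update y i r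
    have hpK : p ∈ Icc a c := hupd x hx r hr
    have hqK : q ∈ Icc a c := hupd y hy r hr
    have hline : ∀ τ : ℝ, HasDerivAt (fun τ : ℝ => p + τ • (q - p)) (q - p) τ := by
      intro τ
      simpa using ((hasDerivAt_id τ).smul_const (q - p)).const_add p
    have hcomp : ∀ τ : ℝ, HasDerivAt (fun τ : ℝ => fderiv ℝ s (p + τ • (q - p)) (Pi.single i 1))
        (fderiv ℝ (fun z => fderiv ℝ s z (Pi.single i 1)) (p + τ • (q - p)) (q - p)) τ := by
      intro τ
      exact (hp _).hasFDerivAt.comp_hasDerivAt τ (hline τ)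
    have hmono : MonotoneOn (fun τ : ℝ => fderiv ℝ s (p + τ • (q - p)) (Pi.single i 1)) (Icc 0 1) := by
      refine monotoneOn_of_deriv_nonneg (convex_Icc 0 1)
        (fun τ _ => (hcomp τ).continuousAt.continuousWithinAt)
        (fun τ _ => (hcomp τ).differentiableAt.differentiableWithinAt) ?_
      intro τ hτ
      have hτ' : τ ∈ Icc (0:ℝ) 1 := interior_subset hτ
      rw [(hcomp τ).deriv]
      have hmem : p + τ • (q - p) ∈ Icc a c :=
        (convex_Icc a c).add_smul_sub_mem hpK hqK hτ'
      have hdec : q - p = ∑ l, (q l - p l) • (Pi.single l (1:ℝ) : Fin d → ℝ) := by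
        ext l
        simp [Finset.sum_apply, Pi.single_apply]
      rw [hdec, map_sum]
      refine Finset.sum_nonneg fun l _ => ?_
      rw [map_smul, ← hdec, smul_eq_mul]
      by_cases hl : l = i
      · subst hl; simp [p, q]
      · refine mul_nonneg ?_ (hsup i l (Ne.symm hl) _ hmem)
        simpa [p, q, hl] using hxy l
    have := hmono (left_mem_Icc.2 zero_le_one) (right_mem_Icc.2 zero_le_one) zero_le_one
    simpa using this
  have hfin : MonotoneOn (fun r => s (Function.update y i r) - s (Function.update x i r)) (Icc (a i) (c i)) := by
    have hdd := fun r => (hder y r).sub (hder x r)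
    refine monotoneOn_of_deriv_nonneg (convex_Icc _ _)
        (fun τ _ => (hdd τ).continuousAt.continuousWithinAt)
        (fun τ _ => (hdd τ).differentiableAt.differentiableWithinAt) ?_
    intro τ hτ
    have := (hdd τ).deriv
    have h2 := hgrad τ (interior_subset hτ)
    calc (0:ℝ) ≤ _ := sub_nonneg.2 h2
      _ = _ := this.symm
  have := hfin ht ht' htt
  simp only at this
  linarith

theorem jmono {d : ℕ} (s : (Fin d → ℝ) → ℝ) (a c : Fin d → ℝ)
    (hm : ∀ i, ∀ x ∈ Icc a c, ∀ t ∈ Icc (a i) (c i), ∀ t' ∈ Icc (a i) (c i),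
      t ≤ t' → s (Function.update x i t) ≤ s (Function.update x i t'))
    (x y : Fin d → ℝ) (hx : x ∈ Icc a c) (hy : y ∈ Icc a c) (hxy : x ≤ y) : s x ≤ s y := by
  have : ∀ S : Finset (Fin d), s x ≤ s (S.piecewise y x) := by
    intro S
    induction S using Finset.induction_on with
    | empty => simp
    | insert i S hi ih =>
      rw [Finset.piecewise_insert]
      refine ih.trans ?_
      have hz : S.piecewise y x ∈ Icc a c := by
        constructor
        · exact Finset.le_piecewise_of_le_of_le _ hy.1 hx.1
        · exact Finset.piecewise_le_of_le_of_le _ hy.2 hx.2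
      have h := hm i _ hz (x i) ⟨hx.1 i, hx.2 i⟩ (y i) ⟨hy.1 i, hy.2 i⟩ (hxy i)
      have e : Function.update (S.piecewise y x) i (x i) = S.piecewise y x := by
        rw [Function.update_eq_iff]; simp [hi]
      rwa [e] at h
  simpa using this Finset.univ

noncomputable def clampR (a c x : ℝ) : ℝ := max a (min x c)

theorem clampR_mem {a c : ℝ} (h : a ≤ c) (x : ℝ) : clampR a c x ∈ Icc a c :=
  ⟨le_max_left _ _, max_le h (min_le_right _ _)⟩

theorem clampR_eq {a c x : ℝ} (h : x ∈ Icc a c) : clampR a c x = x := by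
  simp [clampR, min_eq_left h.2, max_eq_right h.1]

theorem clampR_mono (a c : ℝ) : Monotone (clampR a c) := by
  intro x y h
  exact max_le_max_left _ (min_le_min_right _ h)

theorem clampR_cont (a c : ℝ) : Continuous (clampR a c) := by
  unfold clampR; fun_prop

/-- coordinatewise clamping -/
noncomputable def clampV {D : Type*} (a c : D → ℝ) (x : D → ℝ) : D → ℝ := fun i => clampR (a i) (c i) (x i)

theorem clampV_update {D : Type*} [DecidableEq D] (a c x : D → ℝ) (i : D) (t : ℝ) :
    clampV a c (Function.update x i t) = Function.update (clampV a c x) i (clampR (a i) (c i) t) := by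
  ext l
  by_cases hl : l = i
  · subst hl; simp [clampV]
  · simp [clampV, hl]

theorem clampV_mono {D : Type*} (a c : D → ℝ) : Monotone (clampV a c) :=
  fun _ _ h i => clampR_mono _ _ (h i)

theorem clampV_mem {D : Type*} {a c : D → ℝ} (h : ∀ i, a i ≤ c i) (x : D → ℝ) : clampV a c x ∈ Icc a c :=
  ⟨fun i => (clampR_mem (h i) _).1, fun i => (clampR_mem (h i) _).2⟩

theorem clampV_cont {D : Type*} (a c : D → ℝ) : Continuous (clampV a c) :=
  continuous_pi fun i => (clampR_cont _ _).comp (continuous_apply i)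

/-- joint cost function -/
noncomputable def cost {n d : ℕ} (B : (Fin d → ℝ) → Fin n → ℝ) (z : Fin n ⊕ Fin d → ℝ) : ℝ :=
  ∑ j, B (fun i => z (Sum.inr i)) j * max (z (Sum.inl j)) 0

theorem cost_id {n d : ℕ} (B : (Fin d → ℝ) → Fin n → ℝ)
    (hm : ∀ j x y, x ≤ y → B x j ≤ B y j)
    (hid : ∀ j x y, x ≤ y → ∀ i, ∀ s t : ℝ, s ≤ t →
      B (Function.update x i t) j + B (Function.update y i s) j ≤
      B (Function.update x i s) j + B (Function.update y i t) j)
    (x y : Fin n ⊕ Fin d → ℝ) (hxy : x ≤ y) (k : Fin n ⊕ Fin d) (s t : ℝ) (hst : s ≤ t) :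
      cost B (Function.update x k t) + cost B (Function.update y k s) ≤
      cost B (Function.update x k s) + cost B (Function.update y k t) := by
  unfold cost
  rw [← Finset.sum_add_distrib, ← Finset.sum_add_distrib]
  refine Finset.sum_le_sum fun j _ => ?_
  have hr : (fun i => x (Sum.inr i)) ≤ (fun i => y (Sum.inr i)) := fun i => hxy _
  rcases k with k | i
  · have e : ∀ (z : Fin n ⊕ Fin d → ℝ) r, (fun i => Function.update z (Sum.inl k) r (Sum.inr i)) = fun i => z (Sum.inr i) := by
      intro z r; ext i; simp
    simp only [e]
    have h1 := hm j _ _ hr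
    by_cases hj : j = k
    · subst hj
      simp only [Function.update_self]
      have h2 : max s 0 ≤ max t 0 := max_le_max_right _ hst
      nlinarith [mul_nonneg (sub_nonneg.2 h1) (sub_nonneg.2 h2)]
    · have : (Sum.inl j : Fin n ⊕ Fin d) ≠ Sum.inl k := by simpa using hj
      simp only [Function.update_of_ne this]
      linarith
  · have e : ∀ (z : Fin n ⊕ Fin d → ℝ) r, (fun l => Function.update z (Sum.inr i) r (Sum.inr l)) =
        Function.update (fun l => z (Sum.inr l)) i r := by
      intro z r; ext l
      by_cases hl : l = i
      · subst hl; simp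
      · simp [hl]
    have e2 : ∀ (z : Fin n ⊕ Fin d → ℝ) r, Function.update z (Sum.inr i) r (Sum.inl j) = z (Sum.inl j) := by
      intro z r; simp
    simp only [e, e2]
    have h1 := hid j _ _ hr i s t hst
    have h2 : B (Function.update (fun l => x (Sum.inr l)) i s) j ≤ B (Function.update (fun l => x (Sum.inr l)) i t) j :=
      hm j _ _ (by
        intro l
        by_cases hl : l = i
        · subst hl; simpa using hst
        · simp [hl])
    have h3 : max (x (Sum.inl j)) 0 ≤ max (y (Sum.inl j)) 0 := max_le_max_right _ (hxy _)
    have h4 : 0 ≤ max (x (Sum.inl j)) 0 := le_max_right _ _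
    have h5 := h4.trans h3
    nlinarith [mul_nonneg (sub_nonneg.2 h2) (sub_nonneg.2 h3), mul_nonneg (sub_nonneg.2 h1) h5]

/-- for `ν = f_# Leb_{[0,1]}` concentrated on a smooth curve with
positive increasing components, and `b = (b_1,...,b_n)` with each component
supermodular and increasing in each variable, the image of the comonotone coupling
`(id, F_{μ_1}⁻¹, ..., F_{μ_d}⁻¹)_# Leb_{[0,1]}` under `(m,x) ↦ (f(m), x)` maximizes
`∫ b(x)·y dπ` over `Γ(ν, μ_1, ..., μ_d)`. -/
theorem stmt16 (d n : ℕ) (a c : Fin d → ℝ) (hac : ∀ i, a i ≤ c i)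
    (μ : Fin d → Measure ℝ) (hprob : ∀ i, IsProbabilityMeasure (μ i))
    (hsupp : ∀ i, μ i (Icc (a i) (c i)) = 1)
    (f : ℝ → Fin n → ℝ) (hf : ContDiff ℝ (⊤ : ℕ∞) f)
    (hf_pos : ∀ j, ∀ m ∈ Icc (0:ℝ) 1, 0 < f m j)
    (hf_mono : ∀ j, MonotoneOn (fun m => f m j) (Icc 0 1))
    (ν : Measure (Fin n → ℝ)) (hν : ν = lebI.map f)
    (b : (Fin d → ℝ) → Fin n → ℝ)
    (hb_C2 : ∀ j, ContDiff ℝ 2 (fun x => b x j))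
    (K : Set (Fin d → ℝ)) (hK : K = {x | ∀ i, x i ∈ Icc (a i) (c i)})
    (hb_super : ∀ j, ∀ i i' : Fin d, i ≠ i' →
      ∀ x ∈ K, 0 ≤ partial2 (fun x => b x j) i i' x)
    (hb_mono : ∀ j i, ∀ x ∈ K, ∀ t ∈ Icc (a i) (c i), ∀ t' ∈ Icc (a i) (c i),
      t ≤ t' → b (Function.update x i t) j ≤ b (Function.update x i t') j)
    (π : Measure ((Fin n → ℝ) × (Fin d → ℝ)))
    (hπ : π = lebI.map (fun m => (f m, fun i => quantile (μ i) m))) :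
    (IsProbabilityMeasure π ∧ π.map Prod.fst = ν ∧
      ∀ i, π.map (fun p => p.2 i) = μ i) ∧
    ∀ π' : Measure ((Fin n → ℝ) × (Fin d → ℝ)), IsProbabilityMeasure π' →
      π'.map Prod.fst = ν → (∀ i, π'.map (fun p => p.2 i) = μ i) →
      ∫ p, ∑ j, b p.2 j * p.1 j ∂π' ≤ ∫ p, ∑ j, b p.2 j * p.1 j ∂π := by
  have hfc : Continuous f := hf.continuous
  have hqae : AEMeasurable (fun m i => quantile (μ i) m) lebI :=
    aemeasurable_pi_lambda _ fun i => quantile_aemeas (μ i)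
  have hae : AEMeasurable (fun m => (f m, fun i => quantile (μ i) m)) lebI :=
    hfc.measurable.aemeasurable.prodMk hqae
  have hP : IsProbabilityMeasure π := by
    rw [hπ]; exact Measure.isProbabilityMeasure_map hae
  have hfst : π.map Prod.fst = ν := by
    rw [hπ, hν, AEMeasurable.map_map_of_aemeasurable measurable_fst.aemeasurable hae]
    rfl
  have hsnd : ∀ i, π.map (fun p => p.2 i) = μ i := by
    intro i
    rw [hπ, AEMeasurable.map_map_of_aemeasurable
      (show Measurable (fun p : (Fin n → ℝ) × (Fin d → ℝ) => p.2 i) from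
        (measurable_pi_apply i).comp measurable_snd).aemeasurable hae]
    exact quantile_law (μ i)
  refine ⟨⟨hP, hfst, hsnd⟩, ?_⟩
  have hKI : K = Icc a c := by
    rw [hK]; ext x
    exact ⟨fun h => ⟨fun i => (h i).1, fun i => (h i).2⟩, fun h i => ⟨h.1 i, h.2 i⟩⟩
  rw [hKI] at hb_super hb_mono
  have hf01 : ∀ j, f 0 j ≤ f 1 j := fun j =>
    hf_mono j (left_mem_Icc.2 zero_le_one) (right_mem_Icc.2 zero_le_one) zero_le_one
  set B : (Fin d → ℝ) → Fin n → ℝ := fun x j => b (clampV a c x) j with hB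
  set lo : Fin n ⊕ Fin d → ℝ := Sum.elim (f 0) a with hlo
  set hi : Fin n ⊕ Fin d → ℝ := Sum.elim (f 1) c with hhi
  have hlohi : ∀ k, lo k ≤ hi k := by
    rintro (j | i)
    · exact hf01 j
    · exact hac i
  set X : (Fin n → ℝ) × (Fin d → ℝ) → (Fin n ⊕ Fin d → ℝ) :=
    fun p => clampV lo hi (Sum.elim p.1 p.2) with hX
  have hXm : Measurable X := by
    refine (clampV_cont lo hi).measurable.comp (measurable_pi_lambda _ ?_)
    rintro (j | i)
    · exact (measurable_pi_apply j).comp measurable_fst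
    · exact (measurable_pi_apply i).comp measurable_snd
  have hBc : ∀ j, Continuous (fun x => B x j) := fun j =>
    (hb_C2 j).continuous.comp (clampV_cont a c)
  have hcc : Continuous (cost B) := by
    unfold cost
    refine continuous_finsetSum _ fun j _ => Continuous.mul ?_ ?_
    · exact (hBc j).comp (by fun_prop)
    · fun_prop
  -- replacing the integrand by its clamped version
  have hrepl : ∀ ρ : Measure ((Fin n → ℝ) × (Fin d → ℝ)),
      ρ.map Prod.fst = ν → (∀ i, ρ.map (fun p => p.2 i) = μ i) →
      ∫ p, ∑ j, b p.2 j * p.1 j ∂ρ = ∫ p, cost B (X p) ∂ρ := by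
    intro ρ h1 h2
    refine integral_congr_ae ?_
    have a2 : ∀ᵐ p ∂ρ, ∀ i, p.2 i ∈ Icc (a i) (c i) := by
      rw [ae_all_iff]
      intro i
      have : ∀ᵐ x ∂(μ i), x ∈ Icc (a i) (c i) := by
        have := hprob i
        exact (prob_compl_eq_zero_iff measurableSet_Icc).2 (hsupp i)
      rw [← h2 i] at this
      exact ae_of_ae_map ((measurable_pi_apply i).comp measurable_snd).aemeasurable this
    have a1 : ∀ᵐ p ∂ρ, ∀ j, p.1 j ∈ Icc (f 0 j) (f 1 j) := by
      have h3 : ∀ᵐ y ∂ν, ∀ j, y j ∈ Icc (f 0 j) (f 1 j) := by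
        rw [hν, ae_map_iff hfc.measurable.aemeasurable]
        · unfold lebI
          filter_upwards [ae_restrict_mem measurableSet_Icc] with m hm j
          exact ⟨hf_mono j (left_mem_Icc.2 zero_le_one) hm hm.1,
            hf_mono j hm (right_mem_Icc.2 zero_le_one) hm.2⟩
        · have : {y : Fin n → ℝ | ∀ j, y j ∈ Icc (f 0 j) (f 1 j)} = Icc (f 0) (f 1) := by
            ext x
            exact ⟨fun h => ⟨fun i => (h i).1, fun i => (h i).2⟩, fun h i => ⟨h.1 i, h.2 i⟩⟩
          rw [this]
          exact measurableSet_Icc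
      rw [← h1] at h3
      exact ae_of_ae_map measurable_fst.aemeasurable h3
    filter_upwards [a1, a2] with p q1 q2
    unfold cost
    refine Finset.sum_congr rfl fun j _ => ?_
    have e1 : (fun i => X p (Sum.inr i)) = p.2 := by
      ext i; exact clampR_eq (q2 i)
    have e2 : X p (Sum.inl j) = p.1 j := clampR_eq (q1 j)
    have e3 : clampV a c p.2 = p.2 := by
      ext i; exact clampR_eq (q2 i)
    rw [e1, e2, hB]
    simp only [e3]
    rw [max_eq_left ((hf_pos j 0 (left_mem_Icc.2 zero_le_one)).le.trans (q1 j).1)]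
  intro π' hP' h1' h2'
  rw [hrepl π' h1' h2', hrepl π hfst hsnd]
  set g : ℝ → (Fin n ⊕ Fin d → ℝ) := fun m => X (f (mid m), fun i => quantile (μ i) (mid m)) with hg
  have hgm : Measurable g := by
    refine hXm.comp (Measurable.prodMk (hfc.measurable.comp measurable_mid) ?_)
    exact measurable_pi_lambda _ fun i => quantile_mid_measurable (μ i)
  have hgint : ∫ p, cost B (X p) ∂π = ∫ m, cost B (g m) ∂lebI := by
    rw [hπ, integral_map hae (show Measurable (fun p => cost B (X p)) from
      hcc.measurable.comp hXm).aestronglyMeasurable]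
    refine integral_congr_ae ?_
    filter_upwards [mid_ae] with m hm
    simp only [hg, hm]
  rw [hgint]
  have hmf : ∀ u v, u ∈ Ioo (0:ℝ) 1 → v ∈ Ioo (0:ℝ) 1 → u ≤ v →
      X (f u, fun i => quantile (μ i) u) ≤ X (f v, fun i => quantile (μ i) v) := by
    intro u v hu hv huv
    refine clampV_mono lo hi ?_
    rintro (j | i)
    · exact hf_mono j (Ioo_subset_Icc_self hu) (Ioo_subset_Icc_self hv) huv
    · exact quantile_mono (μ i) hu hv huv
  refine cont π' lebI (cost B) hcc ?_ lo hi X g hXm hgm (fun p => clampV_mem hlohi _)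
    (fun m => clampV_mem hlohi _) ?_ ?_
  · refine cost_id B ?_ ?_
    · intro j x y hxy
      exact jmono (fun x => b x j) a c (hb_mono j) _ _ (clampV_mem hac x) (clampV_mem hac y)
        (clampV_mono a c hxy)
    · intro j x y hxy i s t hst
      simp only [hB, clampV_update]
      exact idiff (fun x => b x j) (hb_C2 j) a c (hb_super j) _ _ (clampV_mem hac x)
        (clampV_mem hac y) (clampV_mono a c hxy) i _ _ (clampR_mem (hac i) s)
        (clampR_mem (hac i) t) (clampR_mono _ _ hst)
  · intro u v
    rcases le_total (mid u) (mid v) with h | h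
    · exact Or.inl (hmf _ _ (mid_mem u) (mid_mem v) h)
    · exact Or.inr (hmf _ _ (mid_mem v) (mid_mem u) h)
  · -- equality of one-dimensional laws, via the coupling π
    have hgl : ∀ k, π.map (fun p => X p k) = lebI.map (fun m => g m k) := by
      intro k
      have hXk : Measurable (fun p => X p k) := (measurable_pi_apply k).comp hXm
      rw [hπ, AEMeasurable.map_map_of_aemeasurable hXk.aemeasurable hae]
      refine Measure.map_congr ?_
      filter_upwards [mid_ae] with m hm
      simp only [hg, hm, Function.comp]
    intro k
    rw [← hgl k]
    have hcl : Measurable (clampR (lo k) (hi k)) := (clampR_cont _ _).measurable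
    rcases k with j | i
    · have e : ∀ ρ : Measure ((Fin n → ℝ) × (Fin d → ℝ)), ρ.map Prod.fst = ν →
          ρ.map (fun p => X p (Sum.inl j)) =
          ν.map (fun y => clampR (lo (Sum.inl j)) (hi (Sum.inl j)) (y j)) := by
        intro ρ h
        rw [← h, Measure.map_map (show Measurable (fun y : Fin n → ℝ =>
          clampR (lo (Sum.inl j)) (hi (Sum.inl j)) (y j)) from hcl.comp (measurable_pi_apply j))
          measurable_fst]
        rfl
      rw [e _ h1', e _ hfst]
    · have e : ∀ ρ : Measure ((Fin n → ℝ) × (Fin d → ℝ)), ρ.map (fun p => p.2 i) = μ i →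
          ρ.map (fun p => X p (Sum.inr i)) =
          (μ i).map (clampR (lo (Sum.inr i)) (hi (Sum.inr i))) := by
        intro ρ h
        rw [← h, Measure.map_map hcl
          (show Measurable (fun p : (Fin n → ℝ) × (Fin d → ℝ) => p.2 i) from
            (measurable_pi_apply i).comp measurable_snd)]
        rfl
      rw [e _ (h2' i), e _ (hsnd i)]
end

section
/- Let X_1, ..., X_d be compact Polish spaces, μ_i ∈ P(X_i), let b : X_1 × ... × X_d → ℝ be continuous and bounded, let m_0 ∈ (0,1], and let α_{m_0} = (1/m_0) · 1_{[1-m_0,1]}. Then the maximal expected shortfall over couplings equals the optimal value of the multi-marginal partial transport problem: max_{γ ∈ Γ(μ_1,...,μ_d)} R_{α_{m_0}}(b_# γ) = max over nonnegative Borel measures σ on X_1 × ... × X_d with total mass m_0 and each i-th marginal dominated by μ_i of (1/m_0) ∫ b(x_1, ..., x_d) dσ(x_1, ..., x_d). -/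
open MeasureTheory Set
open scoped Classical

/-- The spectral risk measure `R_α(μ) = ∫_0^1 F_μ⁻¹(m) α(m) dm`. -/
noncomputable def specRisk (α : ℝ → ℝ) (μ : Measure ℝ) : ℝ :=
  ∫ m in Icc (0:ℝ) 1, quantile μ m * α m

theorem aux_quantile_le_iff (ν : Measure ℝ) [IsProbabilityMeasure ν] {m : ℝ}
    (h0 : 0 < m) (h1 : m < 1) (x : ℝ) : quantile ν m ≤ x ↔ m ≤ ProbabilityTheory.cdf ν x := by
  have hS : {x : ℝ | ENNReal.ofReal m ≤ ν (Iic x)} = {x | m ≤ ProbabilityTheory.cdf ν x} := by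
    ext y
    simp only [mem_ofPred_eq]
    rw [← ProbabilityTheory.ofReal_cdf, ENNReal.ofReal_le_ofReal_iff (ProbabilityTheory.cdf_nonneg ν y)]
  unfold quantile
  rw [hS]
  set F := ProbabilityTheory.cdf ν
  have hne : {x | m ≤ F x}.Nonempty := by
    obtain ⟨y, hy⟩ := ((ProbabilityTheory.tendsto_cdf_atTop ν).eventually (eventually_gt_nhds h1)).exists
    exact ⟨y, hy.le⟩
  have hbb : BddBelow {x | m ≤ F x} := by
    obtain ⟨y, hy⟩ := ((ProbabilityTheory.tendsto_cdf_atBot ν).eventually (eventually_lt_nhds h0)).exists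
    refine ⟨y, fun z hz => ?_⟩
    by_contra hlt
    have := F.mono (not_le.1 hlt).le
    simp only [mem_ofPred_eq] at hz
    have hy' : F y < m := hy
    linarith
  constructor
  · intro h
    have hr : Filter.Tendsto F (nhdsWithin x (Ioi x)) (nhds (F x)) :=
      ((F.right_continuous x).mono Ioi_subset_Ici_self)
    refine ge_of_tendsto hr ?_
    filter_upwards [self_mem_nhdsWithin] with y hy
    obtain ⟨z, hz, hzy⟩ := exists_lt_of_csInf_lt hne (lt_of_le_of_lt h hy)
    exact le_trans hz (F.mono hzy.le)
  · intro h
    exact csInf_le hbb h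

theorem aux_exists_q (ν : Measure ℝ) [IsProbabilityMeasure ν] (C : ℝ) (hC : ν (Iio C) = 0)
    (p : ℝ) (hp0 : 0 ≤ p) (hp1 : p < 1) :
    ∃ q, ν (Iio q) ≤ ENNReal.ofReal p ∧ ENNReal.ofReal p ≤ ν (Iic q) := by
  rcases hp0.eq_or_lt with rfl | hp0
  · exact ⟨C, by simp [hC], by simp⟩
  · refine ⟨quantile ν p, ?_, ?_⟩
    · have hm := ProbabilityTheory.measure_cdf ν
      rw [← hm, StieltjesFunction.measure_Iio _ (ProbabilityTheory.tendsto_cdf_atBot ν), hm]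
      apply ENNReal.ofReal_le_ofReal
      rw [sub_zero]
      refine le_of_tendsto ((ProbabilityTheory.cdf ν).mono.tendsto_leftLim _) ?_
      filter_upwards [self_mem_nhdsWithin] with y hy
      have := (aux_quantile_le_iff ν hp0 hp1 y).not.1 (not_le.2 hy)
      exact (not_le.1 this).le
    · rw [← ProbabilityTheory.ofReal_cdf]
      exact ENNReal.ofReal_le_ofReal ((aux_quantile_le_iff ν hp0 hp1 _).1 le_rfl)

theorem aux_quantile_mono (ν : Measure ℝ) [IsProbabilityMeasure ν] :
    MonotoneOn (quantile ν) (Ioo 0 1) := by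
  intro a ha c hc hac
  rw [aux_quantile_le_iff ν ha.1 ha.2]
  exact hac.trans ((aux_quantile_le_iff ν hc.1 hc.2 _).1 le_rfl)

theorem aux_quantile_map (ν : Measure ℝ) [IsProbabilityMeasure ν] :
    (volume.restrict (Ioo (0:ℝ) 1)).map (quantile ν) = ν := by
  have hae : AEMeasurable (quantile ν) (volume.restrict (Ioo (0:ℝ) 1)) :=
    aemeasurable_restrict_of_monotoneOn measurableSet_Ioo (aux_quantile_mono ν)
  refine Measure.ext_of_Iic _ _ fun x => ?_
  rw [Measure.map_apply_of_aemeasurable hae measurableSet_Iic,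
    Measure.restrict_apply' measurableSet_Ioo]
  have h1 := ProbabilityTheory.cdf_le_one ν x
  have h0 := ProbabilityTheory.cdf_nonneg ν x
  have : quantile ν ⁻¹' Iic x ∩ Ioo 0 1 = Iic (ProbabilityTheory.cdf ν x) ∩ Ioo 0 1 := by
    ext m
    simp only [mem_inter_iff, mem_preimage, mem_Iic, and_congr_left_iff]
    intro hm
    exact aux_quantile_le_iff ν hm.1 hm.2 x
  rw [this, ← ProbabilityTheory.ofReal_cdf]
  apply le_antisymm
  · refine (measure_mono (t := Ioc 0 (ProbabilityTheory.cdf ν x)) ?_).trans (by simp)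
    intro m hm
    exact ⟨hm.2.1, hm.1⟩
  · refine le_trans (by simp) (measure_mono (s := Ioo 0 (ProbabilityTheory.cdf ν x)) ?_)
    intro m hm
    exact ⟨hm.2.le, hm.1, hm.2.trans_le h1⟩

theorem aux_specRisk (ν : Measure ℝ) [IsProbabilityMeasure ν] (hint : Integrable (fun x => x) ν)
    (m₀ : ℝ) (hm₀ : m₀ ∈ Ioc (0:ℝ) 1) (q : ℝ)
    (hq1 : ν (Iio q) ≤ ENNReal.ofReal (1 - m₀)) (hq2 : ENNReal.ofReal (1 - m₀) ≤ ν (Iic q)) :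
    specRisk (fun m => if m ∈ Icc (1 - m₀) 1 then 1 / m₀ else 0) ν
      = (1 / m₀) * (m₀ * q + ∫ x, max (x - q) 0 ∂ν) := by
  have hae : AEMeasurable (quantile ν) (volume.restrict (Ioo (0:ℝ) 1)) :=
    aemeasurable_restrict_of_monotoneOn measurableSet_Ioo (aux_quantile_mono ν)
  have hg : Integrable (fun x => max (x - q) 0) ν := (hint.sub (integrable_const q)).pos_part
  have hgT : IntegrableOn (fun m => max (quantile ν m - q) 0) (Ioo (0:ℝ) 1) := by
    have := (aux_quantile_map ν).symm ▸ hg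
    exact this.comp_aemeasurable hae
  have hgI : ∫ m in Ioo (0:ℝ) 1, max (quantile ν m - q) 0 = ∫ x, max (x - q) 0 ∂ν := by
    conv_rhs => rw [← aux_quantile_map ν]
    rw [integral_map hae]
    exact (by fun_prop : Continuous fun x : ℝ => max (x - q) 0).aestronglyMeasurable
  have hv : volume.real (Icc (1 - m₀) 1 ∩ Ioo (0:ℝ) 1) = m₀ := by
    have : volume (Icc (1 - m₀) 1 ∩ Ioo (0:ℝ) 1) = ENNReal.ofReal m₀ := by
      apply le_antisymm
      · refine (measure_mono inter_subset_left).trans (by simp)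
      · refine le_trans (by simp) (measure_mono (s := Ioo (1 - m₀) 1) ?_)
        intro m hm
        exact ⟨⟨hm.1.le, hm.2.le⟩, by linarith [hm.1, hm₀.2], hm.2⟩
    rw [Measure.real, this, ENNReal.toReal_ofReal hm₀.1.le]
  have hqI : ∫ m in Ioo (0:ℝ) 1, (Icc (1 - m₀) 1).indicator (fun _ => q) m = m₀ * q := by
    rw [integral_indicator measurableSet_Icc, Measure.restrict_restrict measurableSet_Icc]
    simp [hv]
  have hqT : IntegrableOn ((Icc (1 - m₀) 1).indicator (fun _ => q)) (Ioo (0:ℝ) 1) :=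
    (integrable_const q).indicator measurableSet_Icc
  unfold specRisk
  rw [integral_Icc_eq_integral_Ioo, ← hgI, ← hqI, ← integral_add hqT hgT, ← integral_const_mul]
  apply integral_congr_ae
  have hne : ∀ᵐ m ∂(volume.restrict (Ioo (0:ℝ) 1)), m ≠ 1 - m₀ :=
    ae_restrict_of_ae (Measure.ae_ne volume _)
  filter_upwards [hne, ae_restrict_mem measurableSet_Ioo] with m hm hmI
  have hm1 := hmI.2.le
  rcases lt_or_gt_of_ne hm with h | h
  · have hn : m ∉ Icc (1 - m₀) 1 := fun h' => absurd h'.1 (not_le.2 h)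
    have hT : quantile ν m ≤ q := by
      rw [aux_quantile_le_iff ν hmI.1 hmI.2]
      rw [← ProbabilityTheory.ofReal_cdf,
        ENNReal.ofReal_le_ofReal_iff (ProbabilityTheory.cdf_nonneg ν q)] at hq2
      linarith
    simp only [hn, if_false, indicator_of_notMem, not_false_eq_true]
    rw [max_eq_right (by linarith)]; ring
  · have hn : m ∈ Icc (1 - m₀) 1 := ⟨h.le, hm1⟩
    have hT : q ≤ quantile ν m := by
      by_contra hlt
      have h3 := (aux_quantile_le_iff ν hmI.1 hmI.2 (quantile ν m)).1 le_rfl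
      have h4 : ν (Iic (quantile ν m)) ≤ ν (Iio q) :=
        measure_mono (Iic_subset_Iio.2 (not_le.1 hlt))
      rw [← ProbabilityTheory.ofReal_cdf] at h4
      have := (ENNReal.ofReal_le_ofReal_iff (by linarith [hm₀.2])).1 (h4.trans hq1)
      linarith
    simp only [hn, if_true, indicator_of_mem]
    rw [max_eq_left (by linarith)]; ring

/-- Upper bound: any dominated measure of mass `m₀` has smaller integral. -/
theorem aux_le {Z : Type*} [MeasurableSpace Z] (γ σ : Measure Z) [IsProbabilityMeasure γ]
    (b : Z → ℝ) (hb : Integrable b γ) (hσ : σ ≤ γ) (m₀ : ℝ) (h0 : 0 ≤ m₀)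
    (hm : σ univ = ENNReal.ofReal m₀) (q : ℝ) :
    ∫ z, b z ∂σ ≤ m₀ * q + ∫ z, max (b z - q) 0 ∂γ := by
  have : IsFiniteMeasure σ := ⟨by rw [hm]; exact ENNReal.ofReal_lt_top⟩
  have hbσ : Integrable b σ := hb.mono_measure hσ
  have hg : Integrable (fun z => max (b z - q) 0) γ := (hb.sub (integrable_const q)).pos_part
  have h1 : ∫ z, max (b z - q) 0 ∂σ ≤ ∫ z, max (b z - q) 0 ∂γ :=
    integral_mono_measure hσ (Filter.Eventually.of_forall fun z => le_max_right _ _) hg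
  have h2 : ∫ z, (b z - q) ∂σ ≤ ∫ z, max (b z - q) 0 ∂σ :=
    integral_mono (hbσ.sub (integrable_const q)) (hg.mono_measure hσ) fun z => le_max_left _ _
  rw [integral_sub hbσ (integrable_const q), integral_const, Measure.real, hm,
    ENNReal.toReal_ofReal h0, smul_eq_mul] at h2
  linarith

/-- The upper bound is attained. -/
theorem aux_attain {Z : Type*} [MeasurableSpace Z] (γ : Measure Z) [IsProbabilityMeasure γ]
    (b : Z → ℝ) (hbm : Measurable b) (hb : Integrable b γ) (m₀ : ℝ) (hm₀ : m₀ ∈ Ioc (0:ℝ) 1) (q : ℝ)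
    (hq1 : γ {z | b z < q} ≤ ENNReal.ofReal (1 - m₀))
    (hq2 : ENNReal.ofReal (1 - m₀) ≤ γ {z | b z ≤ q}) :
    ∃ σ : Measure Z, σ ≤ γ ∧ σ univ = ENNReal.ofReal m₀ ∧
      ∫ z, b z ∂σ = m₀ * q + ∫ z, max (b z - q) 0 ∂γ := by
  have hA : MeasurableSet {z | q < b z} := measurableSet_lt measurable_const hbm
  have hB : MeasurableSet {z | b z = q} := hbm (measurableSet_singleton q)
  have hL : MeasurableSet {z | b z < q} := measurableSet_lt hbm measurable_const
  have hdisj : Disjoint {z | q < b z} {z | b z = q} := by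
    rw [Set.disjoint_left]; intro z h1 h2; simp only [mem_ofPred_eq] at h1 h2; linarith
  set a := γ.real {z | q < b z} with ha
  set e := γ.real {z | b z = q} with he
  have hle : a ≤ m₀ := by
    have h := measureReal_compl (μ := γ) hA
    have hc : {z | q < b z}ᶜ = {z | b z ≤ q} := by ext; simp
    rw [hc, probReal_univ] at h
    have := (ENNReal.ofReal_le_iff_le_toReal (measure_ne_top _ _)).1 hq2
    change _ ≤ γ.real _ at this
    linarith
  have hge : m₀ ≤ a + e := by
    have h := measureReal_compl (μ := γ) hL
    have hc : {z | b z < q}ᶜ = {z | q < b z} ∪ {z | b z = q} := by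
      ext z; simp [le_iff_lt_or_eq, eq_comm]
    rw [hc, probReal_univ, measureReal_union hdisj hB] at h
    have := ENNReal.toReal_le_of_le_ofReal (by linarith [hm₀.2]) hq1
    change γ.real _ ≤ _ at this
    linarith
  obtain ⟨c, hc0, hc1, hce⟩ : ∃ c : ℝ, 0 ≤ c ∧ c ≤ 1 ∧ a + c * e = m₀ := by
    have he0 : 0 ≤ e := measureReal_nonneg
    rcases he0.eq_or_lt with h | h
    · exact ⟨0, le_rfl, zero_le_one, by linarith⟩
    · exact ⟨(m₀ - a) / e, div_nonneg (by linarith) h.le, (div_le_one h).2 (by linarith),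
        by field_simp; ring⟩
  have hfin : IsFiniteMeasure (ENNReal.ofReal c • γ.restrict {z | b z = q}) :=
    Measure.smul_finite _ ENNReal.ofReal_ne_top
  have hle' : γ.restrict {z | q < b z} + ENNReal.ofReal c • γ.restrict {z | b z = q} ≤ γ := by
    calc _ ≤ γ.restrict {z | q < b z} + γ.restrict {z | b z = q} := by
            gcongr
            refine Measure.le_iff.2 fun s _ => ?_
            rw [Measure.smul_apply, smul_eq_mul]
            exact mul_le_of_le_one_left zero_le (ENNReal.ofReal_le_one.2 hc1)
      _ = γ.restrict ({z | q < b z} ∪ {z | b z = q}) := (Measure.restrict_union hdisj hB).symm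
      _ ≤ γ := Measure.restrict_le_self
  have hmass : (γ.restrict {z | q < b z} + ENNReal.ofReal c • γ.restrict {z | b z = q}) univ
      = ENNReal.ofReal m₀ := by
    simp only [Measure.add_apply, Measure.smul_apply, Measure.restrict_apply_univ, smul_eq_mul]
    rw [← hce, ENNReal.ofReal_add measureReal_nonneg (mul_nonneg hc0 measureReal_nonneg),
      ENNReal.ofReal_mul hc0, ofReal_measureReal, ofReal_measureReal]
  refine ⟨_, hle', hmass, ?_⟩
  rw [integral_add_measure hb.restrict (hb.restrict.smul_measure ENNReal.ofReal_ne_top),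
    integral_smul_measure, ENNReal.toReal_ofReal hc0]
  have e1 : ∫ z in {z | b z = q}, b z ∂γ = e * q := by
    rw [setIntegral_congr_fun hB (g := fun _ => q) (fun z hz => hz)]
    simp [he]
  have e2 : ∫ z, max (b z - q) 0 ∂γ = ∫ z in {z | q < b z}, (b z - q) ∂γ := by
    rw [← integral_indicator hA]
    congr 1
    ext z
    by_cases h : q < b z
    · rw [indicator_of_mem (show z ∈ {z | q < b z} from h), max_eq_left (by linarith)]
    · rw [indicator_of_notMem (show z ∉ {z | q < b z} from h), max_eq_right (by linarith)]
  rw [e1, e2, integral_sub hb.restrict (integrable_const q)]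
  simp only [setIntegral_const, smul_eq_mul]
  rw [← ha, ← hce]; ring

/-- Completing a partial coupling to a coupling. -/
theorem aux_complete (d : ℕ) (X : Fin d → Type*) [∀ i, MeasurableSpace (X i)]
    (μ : ∀ i, Measure (X i)) (hμ : ∀ i, IsProbabilityMeasure (μ i))
    (m₀ : ℝ) (hm₀ : m₀ ∈ Ioc (0:ℝ) 1) (σ : Measure (∀ i, X i))
    (hm : σ univ = ENNReal.ofReal m₀) (hσ : ∀ i, σ.map (fun z => z i) ≤ μ i) :
    ∃ γ : Measure (∀ i, X i), IsProbabilityMeasure γ ∧ (∀ i, γ.map (fun z => z i) = μ i) ∧ σ ≤ γ := by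
  have hfin : IsFiniteMeasure σ := ⟨by rw [hm]; exact ENNReal.ofReal_lt_top⟩
  have hmap : ∀ i, (σ.map (fun z => z i)) univ = ENNReal.ofReal m₀ := fun i => by
    rw [Measure.map_apply (measurable_pi_apply i) MeasurableSet.univ, preimage_univ, hm]
  have hsub : ∀ i, (μ i - σ.map (fun z => z i)) univ = ENNReal.ofReal (1 - m₀) := fun i => by
    rw [Measure.sub_apply MeasurableSet.univ (hσ i), hmap, measure_univ,
      ENNReal.ofReal_sub _ hm₀.1.le, ENNReal.ofReal_one]
  rcases hm₀.2.eq_or_lt with h1 | h1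
  · refine ⟨σ, ⟨by rw [hm, h1, ENNReal.ofReal_one]⟩, fun i => ?_, le_rfl⟩
    have h := Measure.sub_add_cancel_of_le (hσ i)
    have h0 : μ i - σ.map (fun z => z i) = 0 := by
      rw [← Measure.measure_univ_eq_zero, hsub, h1]; simp
    rwa [h0, zero_add] at h
  · set t := ENNReal.ofReal (1 - m₀) with ht
    have ht0 : t ≠ 0 := by rw [ht]; simpa using h1
    have htT : t ≠ ⊤ := ENNReal.ofReal_ne_top
    set ρ : ∀ i, Measure (X i) := fun i => t⁻¹ • (μ i - σ.map (fun z => z i)) with hρ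
    have hρP : ∀ i, IsProbabilityMeasure (ρ i) := fun i =>
      ⟨by rw [hρ]; simp only [Measure.smul_apply, smul_eq_mul]; rw [hsub, ENNReal.inv_mul_cancel ht0 htT]⟩
    refine ⟨σ + t • Measure.pi ρ, ⟨?_⟩, fun i => ?_, Measure.le_add_right le_rfl⟩
    · simp only [Measure.add_apply, Measure.smul_apply, measure_univ, smul_eq_mul, mul_one]
      rw [hm, ht, ← ENNReal.ofReal_add hm₀.1.le (by linarith)]; simp
    · rw [Measure.map_add _ _ (measurable_pi_apply i), Measure.map_smul]
      have := (measurePreserving_eval ρ i).map_eq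
      change Measure.map (fun z => z i) (Measure.pi ρ) = ρ i at this
      rw [this, hρ]
      simp only
      rw [smul_smul, ENNReal.mul_inv_cancel ht0 htT, one_smul, add_comm]
      exact Measure.sub_add_cancel_of_le (hσ i)

/-- Existence of an optimal partial plan. -/
theorem aux_exists (d : ℕ) (X : Fin d → Type*) [∀ i, MeasurableSpace (X i)]
    [∀ i, TopologicalSpace (X i)] [∀ i, PolishSpace (X i)] [∀ i, BorelSpace (X i)]
    [∀ i, CompactSpace (X i)]
    (μ : ∀ i, Measure (X i)) (hμ : ∀ i, IsProbabilityMeasure (μ i))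
    (b : (∀ i, X i) → ℝ) (hb : Continuous b)
    (m₀ : ℝ) (hm₀ : m₀ ∈ Ioc (0:ℝ) 1) :
    ∃ σ : Measure (∀ i, X i), (σ univ = ENNReal.ofReal m₀ ∧ ∀ i, σ.map (fun z => z i) ≤ μ i) ∧
      ∀ τ : Measure (∀ i, X i), (τ univ = ENNReal.ofReal m₀ ∧ ∀ i, τ.map (fun z => z i) ≤ μ i) →
        ∫ z, b z ∂τ ≤ ∫ z, b z ∂σ := by
  set t := ENNReal.ofReal m₀ with ht
  have ht0 : t ≠ 0 := by rw [ht]; simpa using hm₀.1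
  have htT : t ≠ ⊤ := ENNReal.ofReal_ne_top
  let K : Set (ProbabilityMeasure (∀ i, X i)) :=
    {P | ∀ i, ∀ G : Set (X i), IsOpen G → t * (P : Measure (∀ i, X i)) ((fun z => z i) ⁻¹' G) ≤ μ i G}
  have hKc : IsClosed K := by
    have : K = ⋂ i, ⋂ G : Set (X i), ⋂ _ : IsOpen G,
        {P : ProbabilityMeasure (∀ i, X i) |
          (P : Measure (∀ i, X i)) ((fun z => z i) ⁻¹' G) ≤ t⁻¹ * μ i G} := by
      ext P
      simp only [K, mem_ofPred_eq, mem_iInter]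
      refine forall_congr' fun i => forall_congr' fun G => forall_congr' fun _ => ?_
      rw [← ENNReal.div_eq_inv_mul, ENNReal.le_div_iff_mul_le (Or.inl ht0) (Or.inl htT), mul_comm]
    rw [this]
    refine isClosed_iInter fun i => isClosed_iInter fun G => isClosed_iInter fun hG => ?_
    have hO : IsOpen ((fun z : ∀ i, X i => z i) ⁻¹' G) := hG.preimage (continuous_apply i)
    have hlsc : LowerSemicontinuous fun P : ProbabilityMeasure (∀ i, X i) =>
        (P : Measure (∀ i, X i)) ((fun z : ∀ i, X i => z i) ⁻¹' G) := by
      rw [lowerSemicontinuous_iff_le_liminf]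
      intro P
      exact ProbabilityMeasure.le_liminf_measure_open_of_tendsto Filter.tendsto_id hO
    exact hlsc.isClosed_preimage _
  have hfeas : ∀ P ∈ K, (t • (P : Measure (∀ i, X i))) univ = t ∧
      ∀ i, (t • (P : Measure (∀ i, X i))).map (fun z => z i) ≤ μ i := by
    intro P hP
    refine ⟨by simp, fun i => ?_⟩
    refine Measure.le_iff.2 fun s hs => ?_
    rw [Set.measure_eq_iInf_isOpen s (μ i)]
    refine le_iInf fun G => le_iInf fun hsG => le_iInf fun hG => ?_
    refine (measure_mono hsG).trans ?_
    rw [Measure.map_apply (measurable_pi_apply i) hG.measurableSet]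
    exact hP i G hG
  have hconv : ∀ τ : Measure (∀ i, X i), (τ univ = t ∧ ∀ i, τ.map (fun z => z i) ≤ μ i) →
      ∃ P ∈ K, τ = t • (P : Measure (∀ i, X i)) := by
    rintro τ ⟨h1, h2⟩
    have hP : IsProbabilityMeasure (t⁻¹ • τ) :=
      ⟨by rw [Measure.smul_apply, h1, smul_eq_mul, ENNReal.inv_mul_cancel ht0 htT]⟩
    have heq : t • t⁻¹ • τ = τ := by rw [smul_smul, ENNReal.mul_inv_cancel ht0 htT, one_smul]
    refine ⟨⟨t⁻¹ • τ, hP⟩, fun i G hG => ?_, heq.symm⟩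
    have := h2 i G
    rw [Measure.map_apply (measurable_pi_apply i) hG.measurableSet] at this
    refine le_trans (le_of_eq ?_) this
    conv_rhs => rw [← heq]
    rfl
  have hne : K.Nonempty := by
    obtain ⟨P, hP, -⟩ := hconv (t • Measure.pi μ) ⟨by simp, fun i => by
      rw [Measure.map_smul]
      have := (measurePreserving_eval μ i).map_eq
      change Measure.map (fun z => z i) (Measure.pi μ) = μ i at this
      rw [this]
      refine Measure.le_iff.2 fun s _ => ?_
      rw [Measure.smul_apply, smul_eq_mul]
      exact mul_le_of_le_one_left zero_le (ENNReal.ofReal_le_one.2 hm₀.2)⟩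
    exact ⟨P, hP⟩
  have hcont : Continuous fun P : ProbabilityMeasure (∀ i, X i) => ∫ z, b z ∂(P : Measure _) :=
    ProbabilityMeasure.continuous_integral_boundedContinuousFunction
      (BoundedContinuousFunction.mkOfCompact ⟨b, hb⟩)
  obtain ⟨P, hP, hmax⟩ := hKc.isCompact.exists_isMaxOn hne hcont.continuousOn
  refine ⟨t • (P : Measure _), hfeas P hP, fun τ hτ => ?_⟩
  obtain ⟨Q, hQ, rfl⟩ := hconv τ hτ
  rw [integral_smul_measure, integral_smul_measure]
  exact mul_le_mul_of_nonneg_left (hmax hQ) ENNReal.toReal_nonneg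

/-- for the Expected Shortfall spectral function
`α_{m₀} = (1/m₀)·1_{[1-m₀,1]}`, the maximal expected shortfall over couplings equals
the optimal value of the multi-marginal partial transport problem (both maxima being
attained, with a common value `r`). -/
theorem stmt18 (d : ℕ) (X : Fin d → Type*) [∀ i, MeasurableSpace (X i)]
    [∀ i, TopologicalSpace (X i)] [∀ i, PolishSpace (X i)] [∀ i, BorelSpace (X i)]
    [∀ i, CompactSpace (X i)]
    (μ : ∀ i, Measure (X i)) (hμ : ∀ i, IsProbabilityMeasure (μ i))
    (b : (∀ i, X i) → ℝ) (hb_cont : Continuous b) (hb_bdd : ∃ C, ∀ z, |b z| ≤ C)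
    (m₀ : ℝ) (hm₀ : m₀ ∈ Ioc (0:ℝ) 1)
    (α : ℝ → ℝ) (hα : α = fun m => if m ∈ Icc (1 - m₀) 1 then 1 / m₀ else 0) :
    ∃ r : ℝ,
      IsGreatest {v : ℝ | ∃ γ : Measure (∀ i, X i),
        (IsProbabilityMeasure γ ∧ ∀ i, γ.map (fun z => z i) = μ i) ∧
        v = specRisk α (γ.map b)} r ∧
      IsGreatest {v : ℝ | ∃ σ : Measure (∀ i, X i),
        (σ univ = ENNReal.ofReal m₀ ∧ ∀ i, σ.map (fun z => z i) ≤ μ i) ∧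
        v = (1 / m₀) * ∫ z, b z ∂σ} r := by
  subst hα
  have hbm : Measurable b := hb_cont.measurable
  obtain ⟨C, hC⟩ := hb_bdd
  have hint : ∀ γ : Measure (∀ i, X i), IsProbabilityMeasure γ → Integrable b γ := fun γ _ =>
    Integrable.of_bound hbm.aestronglyMeasurable C (Filter.Eventually.of_forall hC)
  -- the key formula for each probability measure
  have key : ∀ γ : Measure (∀ i, X i), IsProbabilityMeasure γ → ∃ q : ℝ,
      γ {z | b z < q} ≤ ENNReal.ofReal (1 - m₀) ∧ ENNReal.ofReal (1 - m₀) ≤ γ {z | b z ≤ q} ∧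
      specRisk (fun m => if m ∈ Icc (1 - m₀) 1 then 1 / m₀ else 0) (γ.map b)
        = (1 / m₀) * (m₀ * q + ∫ z, max (b z - q) 0 ∂γ) := by
    intro γ hγ
    have : IsProbabilityMeasure (γ.map b) := Measure.isProbabilityMeasure_map hbm.aemeasurable
    obtain ⟨q, h1, h2⟩ := aux_exists_q (γ.map b) (-C) (by
      rw [Measure.map_apply hbm measurableSet_Iio]
      convert measure_empty (μ := γ)
      ext z
      have := (abs_le.1 (hC z)).1
      simpa using this) (1 - m₀) (by linarith [hm₀.2]) (by linarith [hm₀.1])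
    refine ⟨q, ?_, ?_, ?_⟩
    · rwa [Measure.map_apply hbm measurableSet_Iio] at h1
    · rwa [Measure.map_apply hbm measurableSet_Iic] at h2
    · have hi : Integrable (fun x : ℝ => x) (γ.map b) :=
        (integrable_map_measure (by fun_prop) hbm.aemeasurable).2 (hint γ hγ)
      rw [aux_specRisk _ hi m₀ hm₀ q h1 h2, integral_map hbm.aemeasurable]
      exact (by fun_prop : Continuous fun x : ℝ => max (x - q) 0).aestronglyMeasurable
  have hpos : 0 ≤ 1 / m₀ := (one_div_pos.2 hm₀.1).le
  obtain ⟨σ, hσ, hmax⟩ := aux_exists d X μ hμ b hb_cont m₀ hm₀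
  have upper : ∀ γ : Measure (∀ i, X i), IsProbabilityMeasure γ →
      (∀ i, γ.map (fun z => z i) = μ i) →
      specRisk (fun m => if m ∈ Icc (1 - m₀) 1 then 1 / m₀ else 0) (γ.map b)
        ≤ (1 / m₀) * ∫ z, b z ∂σ := by
    intro γ hγ hm
    obtain ⟨q, h1, h2, h3⟩ := key γ hγ
    obtain ⟨τ, hτ, hτm, hτi⟩ := aux_attain γ b hbm (hint γ hγ) m₀ hm₀ q h1 h2
    rw [h3, ← hτi]
    refine mul_le_mul_of_nonneg_left (hmax τ ⟨hτm, fun i => ?_⟩) hpos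
    rw [← hm i]
    exact Measure.map_mono hτ (measurable_pi_apply i)
  refine ⟨(1 / m₀) * ∫ z, b z ∂σ, ⟨?_, ?_⟩, ⟨σ, hσ, rfl⟩, ?_⟩
  · obtain ⟨γ, hγ, hm, hle⟩ := aux_complete d X μ hμ m₀ hm₀ σ hσ.1 hσ.2
    refine ⟨γ, ⟨hγ, hm⟩, le_antisymm ?_ (upper γ hγ hm)⟩
    obtain ⟨q, h1, h2, h3⟩ := key γ hγ
    rw [h3]
    exact mul_le_mul_of_nonneg_left
      (aux_le γ σ b (hint γ hγ) hle m₀ hm₀.1.le hσ.1 q) hpos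
  · rintro v ⟨γ, ⟨hγ, hm⟩, rfl⟩
    exact upper γ hγ hm
  · rintro v ⟨τ, hτ, rfl⟩
    exact mul_le_mul_of_nonneg_left (hmax τ hτ) hpos
end
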